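/- There exists an absolute constant C > 0 such that for every odd prime m and all functions u, v : ZMod m → ℝ with |u(x)| ≤ 1 and |v(x)| ≤ 1 for all x, one has |Λ(u,u,u) − Λ(v,v,v)|⁴ ≤ C·m⁵·E(u − v). -/

import Mathlib

/-- The autocorrelation `R_g(t) = ∑_{x ∈ ZMod m} g(x)·g(x+t)`. -/
def autocorr {m : ℕ} [NeZero m] (g : ZMod m → ℝ) (t : ZMod m) : ℝ :=
  ∑ x : ZMod m, g x * g (x + t)

/-- The energy `E(g) = ∑_{t ∈ ZMod m} R_g(t)²`. -/
def energy {m : ℕ} [NeZero m] (g : ZMod m → ℝ) : ℝ :=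
  ∑ t : ZMod m, autocorr g t ^ 2

/-- The trilinear form `Λ(f₁,f₂,f₃) = ∑_{x,r} f₁(x)·f₂(x+r)·f₃(x+2r)`. -/
def lambda3 {m : ℕ} [NeZero m] (f₁ f₂ f₃ : ZMod m → ℝ) : ℝ :=
  ∑ x : ZMod m, ∑ r : ZMod m, f₁ x * f₂ (x + r) * f₃ (x + 2 * r)

/-- Expanding the square of a correlation of `b` with `g` produces autocorrelations of `g`. -/
theorem sum_sq_correlation_eq {m : ℕ} [NeZero m] (b g : ZMod m → ℝ) :
    ∑ x, (∑ y, b y * g (x + y)) ^ 2 = ∑ y, ∑ z, b y * b z * autocorr g (z - y) := by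
  simp_rw [sq, Finset.sum_mul_sum]
  rw [Finset.sum_comm]
  refine Finset.sum_congr rfl fun y _ => ?_
  rw [Finset.sum_comm]
  refine Finset.sum_congr rfl fun z _ => ?_
  rw [autocorr, Finset.mul_sum, ← Equiv.sum_comp (Equiv.subRight y)]
  refine Finset.sum_congr rfl fun x _ => ?_
  rw [Equiv.subRight_apply, sub_add_cancel, show x - y + z = x + (z - y) by ring]
  ring

/-- A bilinear form with kernel `g (x + y)` and `1`-bounded arguments is controlled by the
energy of `g`. -/
theorem bilinear_pow_four_le_energy {m : ℕ} [NeZero m] {a b : ZMod m → ℝ} (g : ZMod m → ℝ)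
    (ha : ∀ x, |a x| ≤ 1) (hb : ∀ x, |b x| ≤ 1) :
    (∑ x, ∑ y, a x * b y * g (x + y)) ^ 4 ≤ (m : ℝ) ^ 5 * energy g := by
  have hasq : ∑ x, a x ^ 2 ≤ (m : ℝ) := by
    simpa [ZMod.card] using
      Finset.sum_le_card_nsmul Finset.univ _ 1 fun x _ => (sq_le_one_iff_abs_le_one _).2 (ha x)
  have hS : (∑ x, ∑ y, a x * b y * g (x + y)) ^ 2
      ≤ m * ∑ y, ∑ z, b y * b z * autocorr g (z - y) := by
    rw [← sum_sq_correlation_eq]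
    simp_rw [mul_assoc, ← Finset.mul_sum]
    refine (Finset.sum_mul_sq_le_sq_mul_sq _ _ _).trans ?_
    gcongr
  have hT : (∑ y, ∑ z, b y * b z * autocorr g (z - y)) ^ 2 ≤ (m : ℝ) ^ 3 * energy g := by
    rw [← Fintype.sum_prod_type']
    refine (sq_sum_le_card_mul_sum_sq).trans ?_
    have hle : ∑ p : ZMod m × ZMod m, (b p.1 * b p.2 * autocorr g (p.2 - p.1)) ^ 2
        ≤ m * energy g := by
      calc ∑ p : ZMod m × ZMod m, (b p.1 * b p.2 * autocorr g (p.2 - p.1)) ^ 2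
          ≤ ∑ p : ZMod m × ZMod m, autocorr g (p.2 - p.1) ^ 2 := by
            refine Finset.sum_le_sum fun p _ => ?_
            rw [mul_pow]
            refine mul_le_of_le_one_left (sq_nonneg _) ((sq_le_one_iff_abs_le_one _).2 ?_)
            rw [abs_mul]
            exact mul_le_one₀ (hb _) (abs_nonneg _) (hb _)
        _ = ∑ y : ZMod m, ∑ z : ZMod m, autocorr g (z - y) ^ 2 := Fintype.sum_prod_type _
        _ = ∑ _y : ZMod m, energy g := by
            refine Finset.sum_congr rfl fun y _ => ?_
            exact Equiv.sum_comp (Equiv.subRight y) fun t => autocorr g t ^ 2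
        _ = m * energy g := by simp [ZMod.card]
    calc _ ≤ ((Finset.univ : Finset (ZMod m × ZMod m)).card : ℝ) * (m * energy g) := by gcongr
      _ = (m : ℝ) ^ 3 * energy g := by
        simp only [Finset.card_univ, Fintype.card_prod, ZMod.card, Nat.cast_mul]
        ring
  calc (∑ x, ∑ y, a x * b y * g (x + y)) ^ 4
      = ((∑ x, ∑ y, a x * b y * g (x + y)) ^ 2) ^ 2 := by ring
    _ ≤ (m * ∑ y, ∑ z, b y * b z * autocorr g (z - y)) ^ 2 := by gcongr
    _ = (m : ℝ) ^ 2 * (∑ y, ∑ z, b y * b z * autocorr g (z - y)) ^ 2 := mul_pow _ _ _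
    _ ≤ (m : ℝ) ^ 2 * ((m : ℝ) ^ 3 * energy g) := by gcongr
    _ = (m : ℝ) ^ 5 * energy g := by ring

/-- Reindexing one argument of the bilinear form by a permutation preserves the energy bound. -/
theorem bilinear_equiv_pow_four_le_energy {m : ℕ} [NeZero m] {a b : ZMod m → ℝ}
    (g : ZMod m → ℝ) (e : ZMod m ≃ ZMod m) (ha : ∀ x, |a x| ≤ 1) (hb : ∀ x, |b x| ≤ 1) :
    (∑ x, ∑ y, a x * b y * g (x + e y)) ^ 4 ≤ (m : ℝ) ^ 5 * energy g := by
  convert bilinear_pow_four_le_energy g ha (fun x => hb (e.symm x)) using 2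
  refine Finset.sum_congr rfl fun x _ => ?_
  rw [← Equiv.sum_comp e fun y => a x * b (e.symm y) * g (x + y)]
  simp

/-- Progressions parametrized by their first and middle terms. -/
theorem lambda3_eq_sum_middle {m : ℕ} [NeZero m] (f₁ f₂ f₃ : ZMod m → ℝ) :
    lambda3 f₁ f₂ f₃ = ∑ x, ∑ y, f₁ x * f₂ y * f₃ (2 * y - x) := by
  refine Finset.sum_congr rfl fun x _ => ?_
  rw [← Equiv.sum_comp (Equiv.subRight x)]
  refine Finset.sum_congr rfl fun r _ => ?_
  rw [Equiv.subRight_apply, add_sub_cancel, show x + 2 * (r - x) = 2 * r - x by ring]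

/-- The trilinear form is symmetric under reversal of progressions. -/
theorem lambda3_reverse {m : ℕ} [NeZero m] (f₁ f₂ f₃ : ZMod m → ℝ) :
    lambda3 f₁ f₂ f₃ = lambda3 f₃ f₂ f₁ := by
  rw [lambda3_eq_sum_middle, lambda3_eq_sum_middle, Finset.sum_comm,
    Finset.sum_comm (f := fun x y => f₃ x * f₂ y * f₁ (2 * y - x))]
  refine Finset.sum_congr rfl fun y _ => ?_
  rw [← Equiv.sum_comp (Equiv.subLeft (2 * y))]
  refine Finset.sum_congr rfl fun x _ => ?_
  rw [Equiv.subLeft_apply, sub_sub_cancel]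
  ring

theorem lambda3_pow_four_le_energy_right {m : ℕ} [NeZero m] (h2 : IsUnit (2 : ZMod m))
    {a b : ZMod m → ℝ} (g : ZMod m → ℝ) (ha : ∀ x, |a x| ≤ 1) (hb : ∀ x, |b x| ≤ 1) :
    lambda3 a b g ^ 4 ≤ (m : ℝ) ^ 5 * energy g := by
  convert bilinear_equiv_pow_four_le_energy g h2.unit.mulLeft (fun x => ha (-x)) hb using 2
  rw [lambda3_eq_sum_middle, ← Equiv.sum_comp (Equiv.neg (ZMod m))]
  simp [sub_eq_add_neg, add_comm]

theorem lambda3_pow_four_le_energy_left {m : ℕ} [NeZero m] (h2 : IsUnit (2 : ZMod m))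
    {a b : ZMod m → ℝ} (g : ZMod m → ℝ) (ha : ∀ x, |a x| ≤ 1) (hb : ∀ x, |b x| ≤ 1) :
    lambda3 g a b ^ 4 ≤ (m : ℝ) ^ 5 * energy g := by
  rw [lambda3_reverse]
  exact lambda3_pow_four_le_energy_right h2 g hb ha

theorem lambda3_pow_four_le_energy_middle {m : ℕ} [NeZero m] (h2 : IsUnit (2 : ZMod m))
    {a b : ZMod m → ℝ} (g : ZMod m → ℝ) (ha : ∀ x, |a x| ≤ 1) (hb : ∀ x, |b x| ≤ 1) :
    lambda3 a g b ^ 4 ≤ (m : ℝ) ^ 5 * energy g := by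
  convert bilinear_pow_four_le_energy g (fun x => ha (2 * x)) (fun x => hb (2 * x)) using 2
  rw [lambda3, ← Equiv.sum_comp h2.unit.mulLeft]
  refine Finset.sum_congr rfl fun x _ => ?_
  rw [← Equiv.sum_comp (Equiv.subRight x)]
  refine Finset.sum_congr rfl fun y _ => ?_
  simp only [Units.mulLeft_apply, IsUnit.unit_spec, Equiv.subRight_apply]
  rw [show 2 * x + (y - x) = x + y by ring, show 2 * x + 2 * (y - x) = 2 * y by ring]
  ring

/-- Telescoping identity for the trilinear form. -/
theorem lambda3_sub_lambda3 {m : ℕ} [NeZero m] (u v : ZMod m → ℝ) :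
    lambda3 u u u - lambda3 v v v
      = lambda3 (u - v) u u + lambda3 v (u - v) u + lambda3 v v (u - v) := by
  simp only [lambda3, ← Finset.sum_add_distrib, ← Finset.sum_sub_distrib, Pi.sub_apply]
  refine Finset.sum_congr rfl fun x _ => Finset.sum_congr rfl fun r _ => ?_
  ring

theorem add_add_pow_four_le (a b c : ℝ) :
    (a + b + c) ^ 4 ≤ 27 * (a ^ 4 + b ^ 4 + c ^ 4) := by
  have h : (a + b + c) ^ 2 ≤ 3 * (a ^ 2 + b ^ 2 + c ^ 2) := by
    nlinarith [sq_nonneg (a - b), sq_nonneg (b - c), sq_nonneg (a - c)]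
  calc (a + b + c) ^ 4 = ((a + b + c) ^ 2) ^ 2 := by ring
    _ ≤ (3 * (a ^ 2 + b ^ 2 + c ^ 2)) ^ 2 := by gcongr
    _ ≤ 27 * (a ^ 4 + b ^ 4 + c ^ 4) := by
      nlinarith [sq_nonneg (a ^ 2 - b ^ 2), sq_nonneg (b ^ 2 - c ^ 2), sq_nonneg (a ^ 2 - c ^ 2)]

/-- There is an absolute constant `C > 0` such that for every odd prime `m` and
all `1`-bounded `u, v : ZMod m → ℝ`,
`|Λ(u,u,u) − Λ(v,v,v)|⁴ ≤ C·m⁵·E(u − v)`. -/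
theorem lambda_diff_pow_four_le_energy :
    ∃ C : ℝ, 0 < C ∧
      ∀ (m : ℕ) [NeZero m], Nat.Prime m → Odd m →
        ∀ u v : ZMod m → ℝ,
          (∀ x, |u x| ≤ 1) → (∀ x, |v x| ≤ 1) →
          |lambda3 u u u - lambda3 v v v| ^ 4
            ≤ C * (m : ℝ) ^ 5 * energy (u - v) := by
  refine ⟨81, by norm_num, fun m _ _ hodd u v hu hv => ?_⟩
  have h2 : IsUnit (2 : ZMod m) := by
    exact_mod_cast (ZMod.isUnit_iff_coprime 2 m).2 hodd.coprime_two_left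
  rw [Even.pow_abs ⟨2, rfl⟩, lambda3_sub_lambda3]
  refine (add_add_pow_four_le _ _ _).trans ?_
  linarith [lambda3_pow_four_le_energy_left h2 (u - v) hu hu,
    lambda3_pow_four_le_energy_middle h2 (u - v) hv hu,
    lambda3_pow_four_le_energy_right h2 (u - v) hv hv]
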